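/- Fix an integer n ≥ 2. There exist constants c, C > 0 depending only on n such that for all 0 < a < b with a/b ∈ (1/2, 1), every principal Dirichlet eigenfunction φ of the annulus A_{a,b} ⊆ ℝⁿ satisfies, for every x ∈ A_{a,b}: c·Ψ(x) ≤ φ(x) ≤ C·Ψ(x), where Ψ(x) := a^{−(n/2+1)} · min{ |x| − a, b − |x| } / (b/a − 1)^{3/2}. -/

import Mathlib

open Real MeasureTheory

noncomputable def dirichletEigenvalue (n : ℕ) (U : Set (EuclideanSpace ℝ (Fin n))) : ℝ :=
  sInf {R : ℝ | ∃ f : EuclideanSpace ℝ (Fin n) → ℝ,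
    ContDiff ℝ (⊤ : ℕ∞) f ∧ HasCompactSupport f ∧ tsupport f ⊆ U ∧ f ≠ 0 ∧
    R = (∫ x, ‖fderiv ℝ f x‖ ^ 2) / (∫ x, (f x) ^ 2)}

def annulus (n : ℕ) (a b : ℝ) : Set (EuclideanSpace ℝ (Fin n)) :=
  {x | a < ‖x‖ ∧ ‖x‖ < b}

/-- The Laplacian as the sum of the unmixed second partial derivatives. -/
noncomputable def laplacian {n : ℕ} (φ : EuclideanSpace ℝ (Fin n) → ℝ)
    (x : EuclideanSpace ℝ (Fin n)) : ℝ :=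
  ∑ i : Fin n, fderiv ℝ (fun y => fderiv ℝ φ y (EuclideanSpace.single i 1)) x
    (EuclideanSpace.single i 1)

/-- `φ` is a principal Dirichlet eigenfunction of the nonempty bounded open set `U`. -/
structure IsPrincipalDirichletEigenfunction {n : ℕ} (U : Set (EuclideanSpace ℝ (Fin n)))
    (φ : EuclideanSpace ℝ (Fin n) → ℝ) : Prop where
  continuousOn : ContinuousOn φ (closure U)
  smooth : ContDiffOn ℝ (⊤ : ℕ∞) φ U
  pos : ∀ x ∈ U, 0 < φ x
  vanishes : ∀ x ∈ frontier U, φ x = 0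
  eigenEq : ∀ x ∈ U, laplacian φ x = -(dirichletEigenvalue n U) * φ x
  normalized : (∫ x in U, (φ x) ^ 2) = 1

open Filter Topology Set

lemma ContDiffAt.differentiableAt_fderiv_apply {E : Type*} [NormedAddCommGroup E] [NormedSpace ℝ E]
    {f : E → ℝ} {x : E} (hf : ContDiffAt ℝ 2 f x) (v : E) :
    DifferentiableAt ℝ (fun y => fderiv ℝ f y v) x := by
  have h : DifferentiableAt ℝ (fderiv ℝ f) x :=
    (hf.fderiv_right (m := 1) (by norm_num)).differentiableAt (by norm_num)
  exact h.clm_apply (differentiableAt_const v)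

lemma ContDiffAt.eventually_hasDerivAt_line {E : Type*} [NormedAddCommGroup E] [NormedSpace ℝ E]
    {f : E → ℝ} {x : E} (hf : ContDiffAt ℝ 2 f x) (v : E) :
    ∀ᶠ t : ℝ in 𝓝 0, HasDerivAt (fun s : ℝ => f (x + s • v)) (fderiv ℝ f (x + t • v) v) t := by
  have hc : Tendsto (fun t : ℝ => x + t • v) (𝓝 0) (𝓝 x) := by
    have : Continuous (fun t : ℝ => x + t • v) := by fun_prop
    simpa using this.tendsto 0
  filter_upwards [hc.eventually (hf.eventually (by simp))] with t ht
  have h1 : HasDerivAt (fun s : ℝ => x + s • v) v t := by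
    simpa using ((hasDerivAt_id t).smul_const v).const_add x
  exact (ht.differentiableAt (by norm_num)).hasFDerivAt.comp_hasDerivAt t h1

lemma ContDiffAt.hasDerivAt_fderiv_line {E : Type*} [NormedAddCommGroup E] [NormedSpace ℝ E]
    {f : E → ℝ} {x : E} (hf : ContDiffAt ℝ 2 f x) (v : E) :
    HasDerivAt (fun t : ℝ => fderiv ℝ f (x + t • v) v)
      (fderiv ℝ (fun y => fderiv ℝ f y v) x v) 0 := by
  have h1 : HasDerivAt (fun s : ℝ => x + s • v) v 0 := by
    simpa using ((hasDerivAt_id (0 : ℝ)).smul_const v).const_add x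
  have h2 := (hf.differentiableAt_fderiv_apply v).hasFDerivAt
  have hx : x = x + (0 : ℝ) • v := by simp
  rw [hx] at h2
  have h3 := h2.comp_hasDerivAt (0 : ℝ) h1
  rwa [← hx] at h3

/-- The second derivative in a direction, computed along a line whose first derivative is known. -/
lemma ContDiffAt.fderiv_fderiv_eq_of_line {E : Type*} [NormedAddCommGroup E] [NormedSpace ℝ E]
    {f : E → ℝ} {x v : E} (hf : ContDiffAt ℝ 2 f x) {g : ℝ → ℝ} {g' : ℝ}
    (hg : ∀ᶠ t : ℝ in 𝓝 0, HasDerivAt (fun s : ℝ => f (x + s • v)) (g t) t)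
    (hg' : HasDerivAt g g' 0) :
    fderiv ℝ (fun y => fderiv ℝ f y v) x v = g' := by
  refine (hf.hasDerivAt_fderiv_line v).unique (hg'.congr_of_eventuallyEq ?_)
  filter_upwards [hg, hf.eventually_hasDerivAt_line v] with t h1 h2 using h2.unique h1

lemma IsLocalMin.fderiv_fderiv_nonneg {E : Type*} [NormedAddCommGroup E] [NormedSpace ℝ E]
    {f : E → ℝ} {x : E} (hf : ContDiffAt ℝ 2 f x) (hm : IsLocalMin f x) (v : E) :
    0 ≤ fderiv ℝ (fun y => fderiv ℝ f y v) x v := by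
  by_contra! hneg
  have hev := hf.eventually_hasDerivAt_line v
  have hd := hf.hasDerivAt_fderiv_line v
  set F : ℝ → ℝ := fun s => f (x + s • v)
  have hc : Tendsto (fun t : ℝ => x + t • v) (𝓝 0) (𝓝 x) := by
    have : Continuous (fun t : ℝ => x + t • v) := by fun_prop
    simpa using this.tendsto 0
  have hmin : IsLocalMin F 0 := by
    filter_upwards [hc.eventually hm] with t ht
    simpa [F] using ht
  have hdF : deriv F =ᶠ[𝓝 0] fun t => fderiv ℝ f (x + t • v) v := by
    filter_upwards [hev] with t ht using ht.deriv
  have hdd : deriv (deriv F) 0 = fderiv ℝ (fun y => fderiv ℝ f y v) x v := by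
    rw [hdF.deriv_eq, hd.deriv]
  have hmax : IsLocalMax F 0 :=
    isLocalMax_of_deriv_deriv_neg (by rw [hdd]; exact hneg) hmin.deriv_eq_zero
      hev.self_of_nhds.continuousAt
  have hconst : F =ᶠ[𝓝 0] fun _ => F 0 := by
    filter_upwards [hmin, hmax] with t h1 h2 using le_antisymm h2 h1
  have : deriv (deriv F) 0 = 0 := by
    have h1 : deriv F =ᶠ[𝓝 0] deriv (fun _ : ℝ => F 0) := hconst.deriv
    rw [h1.deriv_eq]
    simp
  rw [hdd] at this
  linarith

section Laplacian

variable {n : ℕ}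

lemma laplacian_nonneg_of_isLocalMin {f : EuclideanSpace ℝ (Fin n) → ℝ}
    {x : EuclideanSpace ℝ (Fin n)} (hf : ContDiffAt ℝ 2 f x) (hm : IsLocalMin f x) :
    0 ≤ laplacian f x :=
  Finset.sum_nonneg fun _ _ => hm.fderiv_fderiv_nonneg hf _

lemma laplacian_eq_laplacian {f : EuclideanSpace ℝ (Fin n) → ℝ}
    {x : EuclideanSpace ℝ (Fin n)} (hf : ContDiffAt ℝ 2 f x) :
    laplacian f x = Laplacian.laplacian f x := by
  rw [InnerProductSpace.laplacian_eq_iteratedFDeriv_orthonormalBasis f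
    (EuclideanSpace.basisFun (Fin n) ℝ)]
  refine Finset.sum_congr rfl fun i _ => ?_
  have h : DifferentiableAt ℝ (fderiv ℝ f) x :=
    (hf.fderiv_right (m := 1) (by norm_num)).differentiableAt (by norm_num)
  rw [iteratedFDeriv_two_apply, fderiv_clm_apply h (differentiableAt_const _)]
  simp

lemma laplacian_sub_mul {f g : EuclideanSpace ℝ (Fin n) → ℝ} {x : EuclideanSpace ℝ (Fin n)}
    (hf : ContDiffAt ℝ 2 f x) (hg : ContDiffAt ℝ 2 g x) (t : ℝ) :
    laplacian (fun y => f y - t * g y) x = laplacian f x - t * laplacian g x := by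
  have htg : ContDiffAt ℝ 2 (t • g) x := hg.const_smul t
  have h : (fun y => f y - t * g y) = f - t • g := by ext; simp
  rw [h, laplacian_eq_laplacian (f := f - t • g) (hf.sub htg), hf.laplacian_sub htg,
    InnerProductSpace.laplacian_smul t hg, laplacian_eq_laplacian hf, laplacian_eq_laplacian hg]
  simp

lemma laplacian_comp_isometry {f : EuclideanSpace ℝ (Fin n) → ℝ} {x : EuclideanSpace ℝ (Fin n)}
    (R : EuclideanSpace ℝ (Fin n) ≃ₗᵢ[ℝ] EuclideanSpace ℝ (Fin n))
    (hf : ContDiffAt ℝ 2 f (R x)) :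
    laplacian (fun y => f (R y)) x = laplacian f (R x) := by
  have hR : ContDiffAt ℝ 2 (fun y => f (R y)) x := hf.comp x R.contDiff.contDiffAt
  rw [laplacian_eq_laplacian hf, InnerProductSpace.laplacian_eq_iteratedFDeriv_orthonormalBasis f
    ((EuclideanSpace.basisFun (Fin n) ℝ).map R)]
  refine Finset.sum_congr rfl fun i _ => ?_
  have h : DifferentiableAt ℝ (fderiv ℝ f) (R x) :=
    (hf.fderiv_right (m := 1) (by norm_num)).differentiableAt (by norm_num)
  have h2 : iteratedFDeriv ℝ 2 f (R x) ![R (EuclideanSpace.single i 1), R (EuclideanSpace.single i 1)]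
      = fderiv ℝ (fun y => fderiv ℝ f y (R (EuclideanSpace.single i 1))) (R x)
        (R (EuclideanSpace.single i 1)) := by
    rw [iteratedFDeriv_two_apply, fderiv_clm_apply h (differentiableAt_const _)]
    simp
  simp only [OrthonormalBasis.map_apply, EuclideanSpace.basisFun_apply]
  rw [h2]
  refine hR.fderiv_fderiv_eq_of_line ?_ (hf.hasDerivAt_fderiv_line _)
  simpa using hf.eventually_hasDerivAt_line (R (EuclideanSpace.single i 1))

/-- The Laplacian of a function of the squared distance to a point. -/
lemma laplacian_comp_norm_sq {F F' : ℝ → ℝ} {F'' : ℝ} {x y : EuclideanSpace ℝ (Fin n)}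
    (hF : ContDiff ℝ 2 F) (hF' : ∀ s, HasDerivAt F (F' s) s)
    (hF'' : HasDerivAt F' F'' (‖x - y‖ ^ 2)) :
    laplacian (fun z => F (‖z - y‖ ^ 2)) x = 4 * ‖x - y‖ ^ 2 * F'' + 2 * n * F' (‖x - y‖ ^ 2) := by
  have hc : ContDiff ℝ 2 (fun z => F (‖z - y‖ ^ 2)) :=
    hF.comp ((contDiff_id.sub contDiff_const).norm_sq ℝ)
  have hi : ∀ i : Fin n, fderiv ℝ (fun w => fderiv ℝ (fun z => F (‖z - y‖ ^ 2)) w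
      (EuclideanSpace.single i 1)) x (EuclideanSpace.single i 1)
      = 4 * (x - y) i ^ 2 * F'' + 2 * F' (‖x - y‖ ^ 2) := by
    intro i
    obtain ⟨c, hci⟩ : ∃ c : ℝ, (x - y) i = c := ⟨_, rfl⟩
    have hq : ∀ t : ℝ, ‖x + t • EuclideanSpace.single i (1 : ℝ) - y‖ ^ 2
        = ‖x - y‖ ^ 2 + 2 * t * c + t ^ 2 := by
      intro t
      rw [add_sub_right_comm, norm_add_sq_real, inner_smul_right,
        EuclideanSpace.inner_single_right, norm_smul]
      simp [← hci]
      ring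
    have hdq : ∀ t : ℝ, HasDerivAt (fun t : ℝ => ‖x - y‖ ^ 2 + 2 * t * c + t ^ 2)
        (2 * c + 2 * t) t := by
      intro t
      have := (((((hasDerivAt_id t).const_mul 2).mul_const (c)).const_add
        (‖x - y‖ ^ 2)).add ((hasDerivAt_id t).pow 2))
      simpa [Pi.add_def, Pi.pow_def] using this
    refine hc.contDiffAt.fderiv_fderiv_eq_of_line
      (g := fun t => F' (‖x - y‖ ^ 2 + 2 * t * c + t ^ 2) * (2 * c + 2 * t)) ?_ ?_
    · refine Eventually.of_forall fun t => ?_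
      simp only [hq]
      exact (hF' _).comp t (hdq t)
    · have h0 : ‖x - y‖ ^ 2 = ‖x - y‖ ^ 2 + 2 * 0 * c + 0 ^ 2 := by ring
      rw [h0] at hF''
      have h1 := HasDerivAt.comp (0 : ℝ) hF'' (hdq 0)
      have h2 : HasDerivAt (fun t : ℝ => 2 * c + 2 * t) 2 0 := by
        simpa using ((hasDerivAt_id (0 : ℝ)).const_mul 2).const_add (2 * c)
      refine (h1.mul h2).congr_deriv ?_
      simp [hci]
      ring
  rw [laplacian, Finset.sum_congr rfl fun i _ => hi i, Finset.sum_add_distrib, ← Finset.sum_mul,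
    ← Finset.mul_sum, EuclideanSpace.real_norm_sq_eq]
  simp
  ring

end Laplacian

section MaximumPrinciple

variable {n : ℕ}

/-- Minimum principle for `Δ + lam` on a compact set carrying a positive supersolution `g`. -/
lemma nonneg_of_supersolution {K : Set (EuclideanSpace ℝ (Fin n))} (hK : IsCompact K)
    {w g : EuclideanSpace ℝ (Fin n) → ℝ} {lam : ℝ} (hw : ContinuousOn w K) (hg : ContinuousOn g K)
    (hpos : ∀ x ∈ K, 0 < g x)
    (h : ∀ x ∈ K, w x < 0 → K ∈ 𝓝 x ∧ ContDiffAt ℝ 2 w x ∧ ContDiffAt ℝ 2 g x ∧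
      ∀ s > 0, laplacian w x + lam * w x + s * (laplacian g x + lam * g x) < 0) :
    ∀ x ∈ K, 0 ≤ w x := by
  intro x₁ hx₁
  by_contra! hneg
  obtain ⟨x₀, hx₀, hmin⟩ := hK.exists_isMinOn ⟨x₁, hx₁⟩ (hw.div hg fun x hx => (hpos x hx).ne')
  have hq : w x₀ / g x₀ < 0 := (hmin hx₁).trans_lt (div_neg_of_neg_of_pos hneg (hpos x₁ hx₁))
  have hg₀ := hpos x₀ hx₀
  have hw₀ : w x₀ < 0 := by
    by_contra! h0
    exact absurd (div_nonneg h0 hg₀.le) (not_le.2 hq)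
  obtain ⟨hnhds, hwc, hgc, hlt⟩ := h x₀ hx₀ hw₀
  have hlt := hlt (-(w x₀ / g x₀)) (by linarith)
  have heq : w x₀ / g x₀ * g x₀ = w x₀ := div_mul_cancel₀ _ hg₀.ne'
  have hlm : IsLocalMin (fun y => w y - (w x₀ / g x₀) * g y) x₀ := by
    filter_upwards [hnhds] with y hy
    have h1 : w x₀ / g x₀ ≤ w y / g y := hmin hy
    rw [le_div_iff₀ (hpos y hy)] at h1
    linarith
  have := laplacian_nonneg_of_isLocalMin (hwc.sub (contDiffAt_const.mul hgc)) hlm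
  rw [laplacian_sub_mul hwc hgc] at this
  have : lam * w x₀ = lam * (w x₀ / g x₀ * g x₀) := by rw [heq]
  nlinarith

lemma pos_of_superharmonic_ball {U : Set (EuclideanSpace ℝ (Fin n))}
    {w : EuclideanSpace ℝ (Fin n) → ℝ} (hw : ∀ x ∈ U, ContDiffAt ℝ 2 w x)
    (hnonneg : ∀ x ∈ U, 0 ≤ w x) (hsuper : ∀ x ∈ U, laplacian w x ≤ 0)
    {y : EuclideanSpace ℝ (Fin n)} {R : ℝ} (hR : 0 < R) (hball : Metric.closedBall y R ⊆ U)
    (hy : 0 < w y) : ∀ z ∈ Metric.ball y R, 0 < w z := by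
  have hyU : y ∈ U := hball (Metric.mem_closedBall_self hR.le)
  obtain ⟨η₀, hη₀, hη₀'⟩ := Metric.eventually_nhds_iff.1
    ((hw y hyU).continuousAt.eventually (lt_mem_nhds (half_lt_self hy)))
  obtain ⟨η, hη, hηlt⟩ : ∃ η, 0 < η ∧ η < min η₀ R := exists_between (lt_min hη₀ hR)
  have hηball : ∀ z, dist z y ≤ η → w y / 2 < w z := fun z hz =>
    hη₀' (hz.trans_lt (hηlt.trans_le (min_le_left _ _)))
  have hηR : η < R := hηlt.trans_le (min_le_right _ _)
  set m := w y / 2 with hm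
  have hm0 : 0 < m := half_pos hy
  set α : ℝ := (n + 1) / (2 * η ^ 2) with hα
  have hα0 : 0 < α := by positivity
  have hαη : 2 * α * η ^ 2 = n + 1 := by rw [hα]; field_simp
  set F : ℝ → ℝ := fun s => Real.exp (-α * s) - Real.exp (-α * R ^ 2) with hF
  have hFc : ContDiff ℝ 2 F := by fun_prop
  have hlin : ∀ s : ℝ, HasDerivAt (fun s : ℝ => -α * s) (-α) s := fun s => by
    simpa using (hasDerivAt_id s).const_mul (-α)
  have hF' : ∀ s, HasDerivAt F (-α * Real.exp (-α * s)) s := fun s =>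
    ((hlin s).exp.sub_const _).congr_deriv (by ring)
  have hF'' : ∀ s, HasDerivAt (fun s => -α * Real.exp (-α * s)) (α ^ 2 * Real.exp (-α * s)) s :=
    fun s => ((hlin s).exp.const_mul (-α)).congr_deriv (by ring)
  set g : EuclideanSpace ℝ (Fin n) → ℝ := fun z => F (‖z - y‖ ^ 2) with hg
  have hgc : ContDiff ℝ 2 g := hFc.comp ((contDiff_id.sub contDiff_const).norm_sq ℝ)
  have hK : IsCompact (Metric.closedBall y R \ Metric.ball y η) :=
    (isCompact_closedBall y R).diff Metric.isOpen_ball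
  have key := nonneg_of_supersolution (lam := 0) hK (w := fun z => w z - m * g z) (g := fun _ => 1)
    (ContinuousOn.sub (fun z hz => (hw z (hball hz.1)).continuousAt.continuousWithinAt)
      (by have := hgc.continuous; fun_prop)) continuousOn_const (fun _ _ => one_pos) (by
      rintro z ⟨hz1, hz2⟩ hneg
      have hzU := hball hz1
      rw [Metric.mem_closedBall] at hz1
      rw [Metric.mem_ball, not_lt] at hz2
      have hzR : dist z y < R := by
        refine lt_of_le_of_ne hz1 fun h => ?_
        have : g z = 0 := by simp [hg, hF, ← dist_eq_norm, h]
        rw [this] at hneg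
        linarith [hnonneg z hzU]
      have hzη : η < dist z y := by
        refine lt_of_le_of_ne hz2 fun h => ?_
        have h1 : g z ≤ 1 := by
          have : Real.exp (-α * ‖z - y‖ ^ 2) ≤ 1 := Real.exp_le_one_iff.2 (by
            have := sq_nonneg ‖z - y‖
            nlinarith)
          simp only [hg, hF]
          linarith [Real.exp_pos (-α * R ^ 2)]
        have := hηball z h.ge
        nlinarith
      refine ⟨?_, (hw z hzU).sub (contDiffAt_const.mul hgc.contDiffAt), contDiffAt_const,
        fun s _ => ?_⟩
      · refine mem_of_superset ((Metric.isOpen_ball.inter Metric.isClosed_closedBall.isOpen_compl).mem_nhds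
          (⟨hzR, by simpa using hzη⟩ : z ∈ Metric.ball y R ∩ (Metric.closedBall y η)ᶜ)) ?_
        exact fun v hv => ⟨Metric.ball_subset_closedBall hv.1,
          fun h => hv.2 (Metric.ball_subset_closedBall h)⟩
      · have hone : laplacian (fun _ : EuclideanSpace ℝ (Fin n) => (1 : ℝ)) z = 0 := by
          simp [laplacian]
        rw [laplacian_sub_mul (hw z hzU) hgc.contDiffAt, hone,
          laplacian_comp_norm_sq hFc hF' (hF'' _)]
        have h1 := hsuper z hzU
        have h2 : η ^ 2 < ‖z - y‖ ^ 2 := by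
          rw [← dist_eq_norm]
          gcongr
        have h3 : (n : ℝ) < 2 * α * ‖z - y‖ ^ 2 := by nlinarith
        have h4 := Real.exp_pos (-α * ‖z - y‖ ^ 2)
        have h5 : 0 < m * (2 * α * Real.exp (-α * ‖z - y‖ ^ 2) *
          (2 * α * ‖z - y‖ ^ 2 - n)) := by
          have : 0 < 2 * α * ‖z - y‖ ^ 2 - n := by linarith
          positivity
        linarith)
  intro z hz
  rcases le_or_gt (dist z y) η with h | h
  · linarith [hηball z h]
  · have h1 := key z ⟨Metric.ball_subset_closedBall hz, by simpa using h.le⟩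
    have h2 : 0 < g z := by
      have : ‖z - y‖ ^ 2 < R ^ 2 := by
        rw [← dist_eq_norm]
        exact pow_lt_pow_left₀ hz dist_nonneg two_ne_zero
      simp only [hg, hF, sub_pos, Real.exp_lt_exp]
      nlinarith
    nlinarith

/-- Strong maximum principle for nonnegative superharmonic functions. -/
lemma eq_zero_of_superharmonic {U : Set (EuclideanSpace ℝ (Fin n))} (hU : IsOpen U)
    (hconn : IsPreconnected U) {w : EuclideanSpace ℝ (Fin n) → ℝ}
    (hw : ∀ x ∈ U, ContDiffAt ℝ 2 w x) (hnonneg : ∀ x ∈ U, 0 ≤ w x)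
    (hsuper : ∀ x ∈ U, laplacian w x ≤ 0) {x₀ : EuclideanSpace ℝ (Fin n)} (hx₀ : x₀ ∈ U)
    (h0 : w x₀ = 0) : ∀ x ∈ U, w x = 0 := by
  have hopen₁ : IsOpen {x | x ∈ U ∧ 0 < w x} := by
    refine isOpen_iff_mem_nhds.2 fun x hx => ?_
    filter_upwards [hU.mem_nhds hx.1,
      (hw x hx.1).continuousAt.eventually (lt_mem_nhds hx.2)] with y h1 h2 using ⟨h1, h2⟩
  have hopen₂ : IsOpen {x | x ∈ U ∧ w x = 0} := by
    refine Metric.isOpen_iff.2 fun z hz => ?_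
    obtain ⟨r, hr, hrU⟩ := Metric.nhds_basis_closedBall.mem_iff.1 (hU.mem_nhds hz.1)
    refine ⟨r / 2, half_pos hr, fun y hy => ?_⟩
    have hyU : y ∈ U := hrU (by
      rw [Metric.mem_closedBall]
      rw [Metric.mem_ball] at hy
      linarith)
    refine ⟨hyU, ((hnonneg y hyU).eq_or_lt.resolve_right fun hpos => ?_).symm⟩
    refine (pos_of_superharmonic_ball hw hnonneg hsuper (half_pos hr) (y := y) ?_ hpos z
      (by rwa [Metric.mem_ball'])).ne' hz.2
    refine (Metric.closedBall_subset_closedBall' ?_).trans hrU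
    rw [Metric.mem_ball] at hy
    linarith
  have hdisj : Disjoint {x | x ∈ U ∧ w x = 0} {x | x ∈ U ∧ 0 < w x} :=
    Set.disjoint_left.2 fun x h1 h2 => h2.2.ne' h1.2
  rcases hconn.subset_or_subset hopen₂ hopen₁ hdisj fun x hx =>
    (hnonneg x hx).eq_or_lt.imp (fun h => ⟨hx, h.symm⟩) fun h => ⟨hx, h⟩ with h | h
  · exact fun x hx => (h hx).2
  · exact absurd h0 (h hx₀).2.ne'

end MaximumPrinciple

section Annulus

variable {n : ℕ} {a b : ℝ}

lemma isOpen_annulus : IsOpen (annulus n a b) :=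
  (isOpen_lt continuous_const continuous_norm).inter (isOpen_lt continuous_norm continuous_const)

lemma closure_annulus (ha : 0 < a) (hab : a < b) :
    closure (annulus n a b) = {x | a ≤ ‖x‖ ∧ ‖x‖ ≤ b} := by
  refine Subset.antisymm (closure_minimal (fun x hx => ⟨hx.1.le, hx.2.le⟩) ?_) fun x hx => ?_
  · exact (isClosed_le continuous_const continuous_norm).inter
      (isClosed_le continuous_norm continuous_const)
  · have hx0 : 0 < ‖x‖ := ha.trans_le hx.1
    have h := map_mem_closure (f := fun t : ℝ => (t / ‖x‖) • x) (s := Ioo a b)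
      (t := annulus n a b) (x := ‖x‖) (by fun_prop) (by rw [closure_Ioo hab.ne]; exact hx)
      fun t ht => by
        have : ‖(t / ‖x‖) • x‖ = t := by
          rw [norm_smul, norm_div, norm_norm, Real.norm_of_nonneg (ha.trans ht.1).le]
          field_simp
        exact ⟨this.symm ▸ ht.1, this.symm ▸ ht.2⟩
    simpa [hx0.ne'] using h

lemma isCompact_closure_annulus (ha : 0 < a) (hab : a < b) :
    IsCompact {x : EuclideanSpace ℝ (Fin n) | a ≤ ‖x‖ ∧ ‖x‖ ≤ b} := by
  rw [← closure_annulus ha hab]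
  refine (Metric.isBounded_closedBall (x := (0 : EuclideanSpace ℝ (Fin n))) (r := b)).subset
    (fun x hx => ?_) |>.isCompact_closure
  simpa using hx.2.le

lemma mem_frontier_annulus (ha : 0 < a) (hab : a < b) {x : EuclideanSpace ℝ (Fin n)}
    (hx : ‖x‖ = a ∨ ‖x‖ = b) : x ∈ frontier (annulus n a b) := by
  rw [isOpen_annulus.frontier_eq, closure_annulus ha hab]
  rcases hx with h | h
  · exact ⟨⟨h.ge, h.trans_le hab.le⟩, fun h' => h'.1.ne' h⟩
  · exact ⟨⟨hab.le.trans h.ge, h.le⟩, fun h' => h'.2.ne h⟩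

lemma isPreconnected_annulus (hn : 2 ≤ n) (ha : 0 < a) : IsPreconnected (annulus n a b) := by
  have hrank : 1 < Module.rank ℝ (EuclideanSpace ℝ (Fin n)) := by
    rw [← Module.finrank_eq_rank, finrank_euclideanSpace_fin]
    exact_mod_cast hn
  have h := ((isPreconnected_Ioo (a := a) (b := b)).prod
    (isPreconnected_sphere hrank (0 : EuclideanSpace ℝ (Fin n)) 1)).image
    (fun q : ℝ × EuclideanSpace ℝ (Fin n) => q.1 • q.2) (by fun_prop)
  convert h using 1
  ext x
  constructor
  · intro hx
    have hx0 : 0 < ‖x‖ := ha.trans hx.1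
    refine ⟨(‖x‖, ‖x‖⁻¹ • x), ⟨hx, ?_⟩, ?_⟩
    · simp [norm_smul, hx0.ne']
    · simp [smul_smul, hx0.ne']
  · rintro ⟨⟨t, v⟩, ⟨ht, hv⟩, rfl⟩
    have hv : ‖v‖ = 1 := by simpa using hv
    have : ‖t • v‖ = t := by rw [norm_smul, hv, mul_one, Real.norm_of_nonneg (ha.trans ht.1).le]
    exact ⟨this.symm ▸ ht.1, this.symm ▸ ht.2⟩

lemma dirichletEigenvalue_nonneg (U : Set (EuclideanSpace ℝ (Fin n))) :
    0 ≤ dirichletEigenvalue n U := by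
  refine Real.sInf_nonneg ?_
  rintro _ ⟨f, -, -, -, -, rfl⟩
  exact div_nonneg (integral_nonneg fun _ => sq_nonneg _) (integral_nonneg fun _ => sq_nonneg _)

/-- Minimum principle in a layer `|‖x‖² - s₀| ≤ ε` that is thin enough. -/
lemma nonneg_of_thin_layer (ha : 0 < a) (hab : a < b) {lam ε s₀ : ℝ} (hlam : 0 ≤ lam)
    (hε : n * ε ≤ a ^ 2) (hε' : (lam + 1) * ε ^ 2 < 4 * a ^ 2)
    {w : EuclideanSpace ℝ (Fin n) → ℝ} (hw : ContinuousOn w {x | a ≤ ‖x‖ ∧ ‖x‖ ≤ b})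
    (hwC : ∀ x ∈ annulus n a b, ContDiffAt ℝ 2 w x)
    (hbd : ∀ x, ‖x‖ = a ∨ ‖x‖ = b → w x = 0)
    (heq : ∀ x ∈ annulus n a b, laplacian w x = -lam * w x)
    (hlayer : ∀ x ∈ annulus n a b, |‖x‖ ^ 2 - s₀| = ε → 0 ≤ w x) :
    ∀ x ∈ annulus n a b, |‖x‖ ^ 2 - s₀| ≤ ε → 0 ≤ w x := by
  set k : ℝ := (lam + 1) / (4 * a ^ 2) with hk
  have hk0 : 0 < k := by positivity
  have hka : 4 * k * a ^ 2 = lam + 1 := by rw [hk]; field_simp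
  have hkε : k * ε ^ 2 < 1 := by
    rw [hk, div_mul_eq_mul_div, div_lt_one (by positivity)]
    exact hε'
  set F : ℝ → ℝ := fun s => 1 - k * (s - s₀) ^ 2 with hF
  have hFc : ContDiff ℝ 2 F := by fun_prop
  have hlin : ∀ s : ℝ, HasDerivAt (fun s : ℝ => s - s₀) 1 s := fun s =>
    (hasDerivAt_id s).sub_const s₀
  have hF' : ∀ s, HasDerivAt F (-2 * k * (s - s₀)) s := fun s =>
    ((((hlin s).pow 2).const_mul k).const_sub 1).congr_deriv (by simp; ring)
  have hF'' : ∀ s, HasDerivAt (fun s => -2 * k * (s - s₀)) (-2 * k) s := fun s =>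
    ((hlin s).const_mul (-2 * k)).congr_deriv (by ring)
  set g : EuclideanSpace ℝ (Fin n) → ℝ := fun z => F (‖z - 0‖ ^ 2) with hg
  have hgc : ContDiff ℝ 2 g := hFc.comp ((contDiff_id.sub contDiff_const).norm_sq ℝ)
  have hK : IsCompact ({x : EuclideanSpace ℝ (Fin n) | a ≤ ‖x‖ ∧ ‖x‖ ≤ b} ∩
      {x | |‖x‖ ^ 2 - s₀| ≤ ε}) :=
    (isCompact_closure_annulus ha hab).inter_right (isClosed_le (by fun_prop) continuous_const)
  have key := nonneg_of_supersolution (lam := lam) hK (hw.mono inter_subset_left)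
    hgc.continuous.continuousOn ?_ ?_
  · exact fun x hx hxε => key x ⟨⟨hx.1.le, hx.2.le⟩, hxε⟩
  · rintro x ⟨-, hx⟩
    have : (‖x‖ ^ 2 - s₀) ^ 2 ≤ ε ^ 2 := sq_le_sq' (abs_le.1 hx).1 (abs_le.1 hx).2
    simp only [hg, hF, sub_zero]
    nlinarith
  · rintro x ⟨hx, hxε⟩ hneg
    replace hxε : |‖x‖ ^ 2 - s₀| ≤ ε := hxε
    have hxU : x ∈ annulus n a b :=
      ⟨lt_of_le_of_ne hx.1 fun h => hneg.ne (hbd x (Or.inl h.symm)),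
        lt_of_le_of_ne hx.2 fun h => hneg.ne (hbd x (Or.inr h))⟩
    have hlt : |‖x‖ ^ 2 - s₀| < ε :=
      lt_of_le_of_ne hxε fun h => hneg.not_ge (hlayer x hxU h)
    refine ⟨?_, hwC x hxU, hgc.contDiffAt, fun s hs => ?_⟩
    · filter_upwards [isOpen_annulus.mem_nhds hxU,
        (isOpen_lt (f := fun x : EuclideanSpace ℝ (Fin n) => |‖x‖ ^ 2 - s₀|) (by fun_prop)
          continuous_const).mem_nhds hlt] with y h1 h2
      exact ⟨⟨h1.1.le, h1.2.le⟩, h2.le⟩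
    · have h1 : laplacian g x + lam * g x < 0 := by
        rw [hg, laplacian_comp_norm_sq hFc hF' (hF'' _)]
        simp only [sub_zero, hF]
        have hx1 : a ^ 2 ≤ ‖x‖ ^ 2 := by
          have := hx.1
          gcongr
        have h2 : -(‖x‖ ^ 2 - s₀) ≤ ε := by linarith [(abs_le.1 hxε).1]
        have h3 : n * -(‖x‖ ^ 2 - s₀) ≤ a ^ 2 :=
          (mul_le_mul_of_nonneg_left h2 n.cast_nonneg).trans hε
        have h4 : 4 * k * (n * -(‖x‖ ^ 2 - s₀)) ≤ 4 * k * a ^ 2 := by gcongr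
        have h5 : 8 * k * a ^ 2 ≤ 8 * k * ‖x‖ ^ 2 := by gcongr
        have h6 : 0 ≤ lam * (k * (‖x‖ ^ 2 - s₀) ^ 2) := by positivity
        linarith
      rw [heq x hxU]
      have := mul_neg_of_pos_of_neg hs h1
      linarith

lemma IsPrincipalDirichletEigenfunction.contDiffAt {U : Set (EuclideanSpace ℝ (Fin n))}
    {φ : EuclideanSpace ℝ (Fin n) → ℝ} (hφ : IsPrincipalDirichletEigenfunction U φ)
    (hU : IsOpen U) {x : EuclideanSpace ℝ (Fin n)} (hx : x ∈ U) : ContDiffAt ℝ 2 φ x :=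
  contDiffAt_infty.1 (hφ.smooth.contDiffAt (hU.mem_nhds hx)) 2

/-- The principal eigenvalue of an annulus is simple. -/
lemma IsPrincipalDirichletEigenfunction.exists_eq_mul (hn : 2 ≤ n) (ha : 0 < a) (hab : a < b)
    {φ ψ : EuclideanSpace ℝ (Fin n) → ℝ}
    (hφ : IsPrincipalDirichletEigenfunction (annulus n a b) φ)
    (hψ : IsPrincipalDirichletEigenfunction (annulus n a b) ψ) :
    ∃ t : ℝ, ∀ x ∈ annulus n a b, φ x = t * ψ x := by
  have hlam := dirichletEigenvalue_nonneg (annulus n a b)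
  have hφe := hφ.eigenEq
  have hψe := hψ.eigenEq
  set lam := dirichletEigenvalue n (annulus n a b)
  have hcφ := hφ.continuousOn
  have hcψ := hψ.continuousOn
  rw [closure_annulus ha hab] at hcφ hcψ
  obtain ⟨ε, hε0, hε1, hε2, hε3⟩ : ∃ ε : ℝ, 0 < ε ∧ n * ε ≤ a ^ 2 ∧
      (lam + 1) * ε ^ 2 < 4 * a ^ 2 ∧ 2 * ε ≤ b ^ 2 - a ^ 2 := by
    have h1 : ∀ᶠ ε : ℝ in 𝓝 0, n * ε < a ^ 2 :=
      ContinuousAt.eventually_lt (by fun_prop) continuousAt_const (by simpa using by positivity)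
    have h2 : ∀ᶠ ε : ℝ in 𝓝 0, (lam + 1) * ε ^ 2 < 4 * a ^ 2 :=
      ContinuousAt.eventually_lt (by fun_prop) continuousAt_const (by simpa using by positivity)
    have h3 : ∀ᶠ ε : ℝ in 𝓝 0, 2 * ε < b ^ 2 - a ^ 2 :=
      ContinuousAt.eventually_lt (by fun_prop) continuousAt_const (by nlinarith)
    obtain ⟨ε, ⟨⟨h1, h2⟩, h3⟩, h4⟩ := (((h1.and h2).and h3).filter_mono
      (nhdsWithin_le_nhds (s := Ioi 0)) |>.and self_mem_nhdsWithin).exists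
    exact ⟨ε, h4, h1.le, h2, h3.le⟩
  have hKU : {x : EuclideanSpace ℝ (Fin n) | a ≤ ‖x‖ ∧ ‖x‖ ≤ b} ∩
      {x | a ^ 2 + ε ≤ ‖x‖ ^ 2 ∧ ‖x‖ ^ 2 ≤ b ^ 2 - ε} ⊆ annulus n a b := by
    rintro x ⟨-, hx1, hx2⟩
    exact ⟨lt_of_pow_lt_pow_left₀ 2 (norm_nonneg x) (by linarith),
      lt_of_pow_lt_pow_left₀ 2 (ha.trans hab).le (by linarith)⟩
  have hK : IsCompact ({x : EuclideanSpace ℝ (Fin n) | a ≤ ‖x‖ ∧ ‖x‖ ≤ b} ∩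
      {x | a ^ 2 + ε ≤ ‖x‖ ^ 2 ∧ ‖x‖ ^ 2 ≤ b ^ 2 - ε}) :=
    (isCompact_closure_annulus ha hab).inter_right
      ((isClosed_le (f := fun _ => a ^ 2 + ε) (g := fun x => ‖x‖ ^ 2) (by fun_prop)
        (by fun_prop)).inter (isClosed_le (f := fun x => ‖x‖ ^ 2) (g := fun _ => b ^ 2 - ε)
        (by fun_prop) (by fun_prop)))
  have hKne : ({x : EuclideanSpace ℝ (Fin n) | a ≤ ‖x‖ ∧ ‖x‖ ≤ b} ∩
      {x | a ^ 2 + ε ≤ ‖x‖ ^ 2 ∧ ‖x‖ ^ 2 ≤ b ^ 2 - ε}).Nonempty := by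
    have hs : ‖EuclideanSpace.single (⟨0, by omega⟩ : Fin n) √((a ^ 2 + b ^ 2) / 2)‖ ^ 2
        = (a ^ 2 + b ^ 2) / 2 := by
      rw [PiLp.norm_single, Real.norm_of_nonneg (Real.sqrt_nonneg _),
        Real.sq_sqrt (by positivity)]
    set v := EuclideanSpace.single (⟨0, by omega⟩ : Fin n) √((a ^ 2 + b ^ 2) / 2)
    have h1 : a ^ 2 + ε ≤ ‖v‖ ^ 2 ∧ ‖v‖ ^ 2 ≤ b ^ 2 - ε := by
      rw [hs]
      constructor <;> linarith
    exact ⟨v, ⟨(pow_le_pow_iff_left₀ ha.le (norm_nonneg v) two_ne_zero).1 (by linarith),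
      (pow_le_pow_iff_left₀ (norm_nonneg v) (ha.trans hab).le two_ne_zero).1 (by linarith)⟩, h1⟩
  obtain ⟨x₀, hx₀, hmin⟩ := hK.exists_isMinOn hKne
    ((hcφ.mono inter_subset_left).div (hcψ.mono inter_subset_left)
      fun x hx => (hψ.pos x (hKU hx)).ne')
  have hx₀U := hKU hx₀
  set t := φ x₀ / ψ x₀ with ht
  refine ⟨t, ?_⟩
  have hwC : ∀ x ∈ annulus n a b, ContDiffAt ℝ 2 (fun x => φ x - t * ψ x) x := fun x hx =>
    (hφ.contDiffAt isOpen_annulus hx).sub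
      (contDiffAt_const.mul (hψ.contDiffAt isOpen_annulus hx))
  have hw : ContinuousOn (fun x => φ x - t * ψ x) {x | a ≤ ‖x‖ ∧ ‖x‖ ≤ b} :=
    hcφ.sub (continuousOn_const.mul hcψ)
  have hbd : ∀ x, ‖x‖ = a ∨ ‖x‖ = b → φ x - t * ψ x = 0 := fun x hx => by
    simp [hφ.vanishes x (mem_frontier_annulus ha hab hx),
      hψ.vanishes x (mem_frontier_annulus ha hab hx)]
  have heq : ∀ x ∈ annulus n a b,
      laplacian (fun x => φ x - t * ψ x) x = -lam * (φ x - t * ψ x) := fun x hx => by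
    rw [laplacian_sub_mul (hφ.contDiffAt isOpen_annulus hx) (hψ.contDiffAt isOpen_annulus hx),
      hφe x hx, hψe x hx]
    ring
  have hcore : ∀ x ∈ annulus n a b, a ^ 2 + ε ≤ ‖x‖ ^ 2 → ‖x‖ ^ 2 ≤ b ^ 2 - ε →
      0 ≤ φ x - t * ψ x := fun x hx h1 h2 => by
    have h : t ≤ φ x / ψ x := hmin ⟨⟨hx.1.le, hx.2.le⟩, h1, h2⟩
    rw [le_div_iff₀ (hψ.pos x hx)] at h
    linarith
  have hsq : ∀ x ∈ annulus n a b, a ^ 2 < ‖x‖ ^ 2 ∧ ‖x‖ ^ 2 < b ^ 2 := fun x hx =>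
    ⟨pow_lt_pow_left₀ hx.1 ha.le two_ne_zero, pow_lt_pow_left₀ hx.2 (norm_nonneg x) two_ne_zero⟩
  have hlayer : ∀ s₀, s₀ = a ^ 2 ∨ s₀ = b ^ 2 →
      ∀ x ∈ annulus n a b, |‖x‖ ^ 2 - s₀| ≤ ε → 0 ≤ φ x - t * ψ x := fun s₀ hs₀ =>
    nonneg_of_thin_layer ha hab hlam hε1 hε2 hw hwC hbd heq fun x hx hxε => by
      obtain ⟨h1, h2⟩ := hsq x hx
      rcases hs₀ with rfl | rfl
      · rw [abs_of_pos (by linarith)] at hxε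
        exact hcore x hx (by linarith) (by linarith)
      · rw [abs_of_neg (by linarith)] at hxε
        exact hcore x hx (by linarith) (by linarith)
  have hnonneg : ∀ x ∈ annulus n a b, 0 ≤ φ x - t * ψ x := fun x hx => by
    obtain ⟨h1, h2⟩ := hsq x hx
    by_cases h3 : a ^ 2 + ε ≤ ‖x‖ ^ 2
    · by_cases h4 : ‖x‖ ^ 2 ≤ b ^ 2 - ε
      · exact hcore x hx h3 h4
      · exact hlayer _ (Or.inr rfl) x hx (abs_le.2 ⟨by linarith, by linarith⟩)
    · exact hlayer _ (Or.inl rfl) x hx (abs_le.2 ⟨by linarith, by linarith⟩)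
  have hzero := eq_zero_of_superharmonic isOpen_annulus (isPreconnected_annulus hn ha) hwC hnonneg
    (fun x hx => by
      rw [heq x hx]
      have := mul_nonneg hlam (hnonneg x hx)
      linarith) hx₀U (by rw [ht, div_mul_cancel₀ _ (hψ.pos x₀ hx₀U).ne', sub_self])
  exact fun x hx => sub_eq_zero.1 (hzero x hx)

lemma IsPrincipalDirichletEigenfunction.comp_isometry
    {φ : EuclideanSpace ℝ (Fin n) → ℝ}
    (hφ : IsPrincipalDirichletEigenfunction (annulus n a b) φ)
    (R : EuclideanSpace ℝ (Fin n) ≃ₗᵢ[ℝ] EuclideanSpace ℝ (Fin n)) :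
    IsPrincipalDirichletEigenfunction (annulus n a b) (fun x => φ (R x)) := by
  have hmem : R ⁻¹' annulus n a b = annulus n a b := by
    ext x
    simp [annulus]
  have hcl : R ⁻¹' closure (annulus n a b) = closure (annulus n a b) := by
    have := R.toHomeomorph.preimage_closure (annulus n a b)
    exact this.trans (congrArg closure hmem)
  have hfr : R ⁻¹' frontier (annulus n a b) = frontier (annulus n a b) := by
    have := R.toHomeomorph.preimage_frontier (annulus n a b)
    exact this.trans (congrArg frontier hmem)
  have hmem' : ∀ x ∈ annulus n a b, R x ∈ annulus n a b := fun x hx => by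
    rwa [← hmem] at hx
  refine ⟨hφ.continuousOn.comp R.continuous.continuousOn fun x hx => ?_,
    hφ.smooth.comp R.contDiff.contDiffOn hmem', fun x hx => hφ.pos _ (hmem' x hx),
    fun x hx => hφ.vanishes _ ?_, fun x hx => ?_, ?_⟩
  · rwa [← hcl] at hx
  · rwa [← hfr] at hx
  · rw [laplacian_comp_isometry R (hφ.contDiffAt isOpen_annulus (hmem' x hx)),
      hφ.eigenEq _ (hmem' x hx)]
  · have := R.measurePreserving.setIntegral_preimage_emb R.toHomeomorph.measurableEmbedding
      (fun x => φ x ^ 2) (annulus n a b)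
    rw [hmem] at this
    rw [this, hφ.normalized]

/-- Principal eigenfunctions of an annulus are radial. -/
lemma IsPrincipalDirichletEigenfunction.eq_of_norm_eq (hn : 2 ≤ n) (ha : 0 < a) (hab : a < b)
    {φ : EuclideanSpace ℝ (Fin n) → ℝ}
    (hφ : IsPrincipalDirichletEigenfunction (annulus n a b) φ)
    {x y : EuclideanSpace ℝ (Fin n)} (hx : x ∈ annulus n a b) (hxy : ‖x‖ = ‖y‖) : φ x = φ y := by
  have hy : y ∈ annulus n a b := ⟨hxy ▸ hx.1, hxy ▸ hx.2⟩
  set R := (ℝ ∙ (x - y))ᗮ.reflection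
  have hRx : R x = y := Submodule.reflection_sub hxy
  have hRy : R y = x := by rw [← hRx, Submodule.reflection_reflection]
  obtain ⟨t, ht⟩ := hφ.exists_eq_mul hn ha hab (hφ.comp_isometry R)
  have h1 := ht x hx
  have h2 := ht y hy
  simp only [hRx, hRy] at h1 h2
  have hpx := hφ.pos x hx
  have hpy := hφ.pos y hy
  have ht0 : 0 < t := pos_of_mul_pos_left (h1 ▸ hpx) hpy.le
  have : t ^ 2 = 1 := by
    have : (t ^ 2 - 1) * φ x = 0 := by rw [h2] at h1; linear_combination -h1
    linarith [(mul_eq_zero.1 this).resolve_right hpx.ne']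
  have ht1 : t = 1 := by nlinarith
  rw [h1, ht1, one_mul]

end Annulus

/-- A positive solution `u` of the Sturm-Liouville problem `(ρ u')' = -lam ρ u` on `(a, b)` with
Dirichlet boundary values, where `v = u'` and the weight satisfies `A ≤ ρ ≤ Q A`. -/
structure SturmProfile (a b lam A Q : ℝ) (u v ρ : ℝ → ℝ) : Prop where
  lt : a < b
  eigen_nonneg : 0 ≤ lam
  weight_pos : 0 < A
  one_le : 1 ≤ Q
  cont : ContinuousOn u (Icc a b)
  left : u a = 0
  right : u b = 0
  pos : ∀ r ∈ Ioo a b, 0 < u r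
  deriv : ∀ r ∈ Ioo a b, HasDerivAt u (v r) r
  flux : ∀ r ∈ Ioo a b, HasDerivAt (fun s => ρ s * v s) (-lam * ρ r * u r) r
  lower : ∀ r ∈ Ioo a b, A ≤ ρ r
  upper : ∀ r ∈ Ioo a b, ρ r ≤ Q * A

namespace SturmProfile

variable {a b lam A Q : ℝ} {u v ρ : ℝ → ℝ}

lemma reflect (h : SturmProfile a b lam A Q u v ρ) :
    SturmProfile a b lam A Q (fun r => u (a + b - r)) (fun r => -v (a + b - r))
      (fun r => ρ (a + b - r)) := by
  have hIoo : ∀ r ∈ Ioo a b, a + b - r ∈ Ioo a b := fun r hr =>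
    ⟨by linarith [hr.2], by linarith [hr.1]⟩
  have hlin : ∀ r, HasDerivAt (fun s => a + b - s) (-1) r := fun r =>
    (hasDerivAt_id r).const_sub (a + b)
  refine ⟨h.lt, h.eigen_nonneg, h.weight_pos, h.one_le, ?_, by simpa using h.right,
    by simpa using h.left, fun r hr => h.pos _ (hIoo r hr), fun r hr => ?_, fun r hr => ?_,
    fun r hr => h.lower _ (hIoo r hr), fun r hr => h.upper _ (hIoo r hr)⟩
  · exact h.cont.comp (by fun_prop) fun r hr => ⟨by linarith [hr.2], by linarith [hr.1]⟩
  · exact ((h.deriv _ (hIoo r hr)).comp r (hlin r)).congr_deriv (by ring)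
  · have := ((h.flux _ (hIoo r hr)).comp r (hlin r)).neg
    refine (this.congr_deriv (by ring)).congr_of_eventuallyEq (Eventually.of_forall fun s => ?_)
    simp

lemma flux_anti (h : SturmProfile a b lam A Q u v ρ) {r s : ℝ} (hr : r ∈ Ioo a b)
    (hs : s ∈ Ioo a b) (hrs : r ≤ s) : ρ s * v s ≤ ρ r * v r := by
  refine antitoneOn_of_deriv_nonpos (f := fun s => ρ s * v s) (convex_Ioo a b)
    (fun x hx => (h.flux x hx).continuousAt.continuousWithinAt) ?_ ?_ hr hs hrs
  · rw [interior_Ioo]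
    exact fun x hx => (h.flux x hx).differentiableAt.differentiableWithinAt
  · rw [interior_Ioo]
    intro x hx
    rw [(h.flux x hx).deriv]
    have := mul_nonneg (mul_nonneg h.eigen_nonneg (h.weight_pos.le.trans (h.lower x hx)))
      (h.pos x hx).le
    linarith

lemma exists_max (h : SturmProfile a b lam A Q u v ρ) :
    ∃ r₀ ∈ Ioo a b, v r₀ = 0 ∧ ∀ r ∈ Ioo a b, u r ≤ u r₀ := by
  obtain ⟨r₀, hr₀, hmax⟩ := isCompact_Icc.exists_isMaxOn (nonempty_Icc.2 h.lt.le) h.cont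
  have hmid : (a + b) / 2 ∈ Ioo a b := ⟨by linarith [h.lt], by linarith [h.lt]⟩
  have hpos : 0 < u r₀ := (h.pos _ hmid).trans_le (hmax (Ioo_subset_Icc_self hmid))
  have hr₀' : r₀ ∈ Ioo a b :=
    ⟨lt_of_le_of_ne hr₀.1 fun e => hpos.ne' (e ▸ h.left),
      lt_of_le_of_ne hr₀.2 fun e => hpos.ne' (e ▸ h.right)⟩
  refine ⟨r₀, hr₀', ?_, fun r hr => hmax (Ioo_subset_Icc_self hr)⟩
  exact (hmax.isLocalMax (Icc_mem_nhds hr₀'.1 hr₀'.2)).hasDerivAt_eq_zero (h.deriv r₀ hr₀')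

lemma exists_slope_left (h : SturmProfile a b lam A Q u v ρ) {r : ℝ} (hr : r ∈ Ioo a b) :
    ∃ ξ ∈ Ioo a b, ξ < r ∧ u r = (r - a) * v ξ := by
  obtain ⟨ξ, hξ, he⟩ := exists_hasDerivAt_eq_slope u v hr.1
    (h.cont.mono (Icc_subset_Icc_right hr.2.le)) fun x hx => h.deriv x ⟨hx.1, hx.2.trans hr.2⟩
  refine ⟨ξ, ⟨hξ.1, hξ.2.trans hr.2⟩, hξ.2, ?_⟩
  rw [he, h.left, sub_zero, mul_div_cancel₀ _ (sub_pos.2 hr.1).ne']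

lemma flux_le (h : SturmProfile a b lam A Q u v ρ) {r : ℝ} (hr : r ∈ Ioo a b) :
    ρ r * v r * (r - a) ≤ Q * A * u r := by
  obtain ⟨ξ, hξ, hξr, he⟩ := h.exists_slope_left hr
  have hra : 0 < r - a := sub_pos.2 hr.1
  have hv : 0 < v ξ := pos_of_mul_pos_right (he ▸ h.pos r hr) hra.le
  have h1 := h.flux_anti hξ hr hξr.le
  have h2 : ρ ξ * v ξ ≤ Q * A * v ξ := mul_le_mul_of_nonneg_right (h.upper ξ hξ) hv.le
  calc ρ r * v r * (r - a) ≤ Q * A * v ξ * (r - a) :=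
        mul_le_mul_of_nonneg_right (h1.trans h2) hra.le
    _ = Q * A * u r := by rw [he]; ring

lemma mul_slope_le (h : SturmProfile a b lam A Q u v ρ) {r B : ℝ} (hr : r ∈ Ioo a b)
    (hB : 0 ≤ B) (hle : ρ r * v r ≤ B) : A * v r ≤ B := by
  rcases le_or_gt (v r) 0 with hv | hv
  · exact (mul_nonpos_of_nonneg_of_nonpos h.weight_pos.le hv).trans hB
  · exact (mul_le_mul_of_nonneg_right (h.lower r hr) hv.le).trans hle

lemma lower_left (h : SturmProfile a b lam A Q u v ρ) {r₀ : ℝ} (hr₀ : r₀ ∈ Ioo a b)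
    (hv₀ : v r₀ = 0) {r : ℝ} (hr : r ∈ Ioo a b) (hrr : r ≤ r₀) :
    u r₀ * (r - a) ≤ Q * (b - a) * u r := by
  have hra : 0 < r - a := sub_pos.2 hr.1
  have hu := h.pos r hr
  have hQ := h.one_le
  have hA := h.weight_pos
  rcases hrr.eq_or_lt with rfl | hlt
  · have h1 : r - a ≤ Q * (b - a) := by nlinarith [hr.2]
    nlinarith
  · obtain ⟨η, hη, he⟩ := exists_hasDerivAt_eq_slope u v hlt
      (h.cont.mono (Icc_subset_Icc hr.1.le hr₀.2.le))
      fun x hx => h.deriv x ⟨hr.1.trans hx.1, hx.2.trans hr₀.2⟩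
    have hη' : η ∈ Ioo a b := ⟨hr.1.trans hη.1, hη.2.trans hr₀.2⟩
    have h0 : 0 ≤ ρ r * v r := by simpa [hv₀] using h.flux_anti hr hr₀ hrr
    have h1 := h.mul_slope_le hη' h0 (h.flux_anti hr hη' hη.1.le)
    have h2 := h.flux_le hr
    have h3 : A * (v η * (r - a)) ≤ A * (Q * u r) := by nlinarith
    have h4 : v η * (r - a) ≤ Q * u r := le_of_mul_le_mul_left h3 hA
    have h5 : u r₀ - u r = v η * (r₀ - r) := by
      rw [he, div_mul_cancel₀ _ (sub_pos.2 hlt).ne']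
    have h6 : v η * (r - a) * (r₀ - r) ≤ Q * u r * (r₀ - r) :=
      mul_le_mul_of_nonneg_right h4 (sub_pos.2 hlt).le
    have h7 : u r * (r - a) ≤ Q * u r * (r - a) := by
      nlinarith [mul_pos hu hra]
    have h8 : Q * u r * (r₀ - a) ≤ Q * u r * (b - a) :=
      mul_le_mul_of_nonneg_left (by linarith [hr₀.2]) (by positivity)
    calc u r₀ * (r - a) = u r * (r - a) + v η * (r - a) * (r₀ - r) := by
          linear_combination (r - a) * h5
      _ ≤ Q * u r * (r₀ - a) := by linarith
      _ ≤ Q * (b - a) * u r := by linarith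

lemma lower_bound (h : SturmProfile a b lam A Q u v ρ) {r₀ : ℝ} (hr₀ : r₀ ∈ Ioo a b)
    (hv₀ : v r₀ = 0) {r : ℝ} (hr : r ∈ Ioo a b) :
    u r₀ * min (r - a) (b - r) ≤ Q * (b - a) * u r := by
  have hu₀ := h.pos r₀ hr₀
  rcases le_total r r₀ with hrr | hrr
  · exact (mul_le_mul_of_nonneg_left (min_le_left _ _) hu₀.le).trans (h.lower_left hr₀ hv₀ hr hrr)
  · have := h.reflect.lower_left (r₀ := a + b - r₀) ⟨by linarith [hr₀.2], by linarith [hr₀.1]⟩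
      (by simpa using hv₀) (r := a + b - r) ⟨by linarith [hr.2], by linarith [hr.1]⟩ (by linarith)
    simp only [sub_sub_cancel] at this
    refine (mul_le_mul_of_nonneg_left (min_le_right _ _) hu₀.le).trans (le_trans ?_ this)
    exact mul_le_mul_of_nonneg_left (by linarith) hu₀.le

lemma eigen_mul_sq_le (h : SturmProfile a b lam A Q u v ρ) :
    lam * (b - a) ^ 2 ≤ 64 * Q ^ 2 := by
  obtain ⟨r₀, hr₀, hv₀, hmax⟩ := h.exists_max
  have hab := h.lt
  have hM := h.pos r₀ hr₀
  have hA := h.weight_pos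
  have hQ := h.one_le
  have hd : 0 < b - a := sub_pos.2 hab
  have hr₁ : a + (b - a) / 4 ∈ Ioo a b := ⟨by linarith, by linarith⟩
  have hr₂ : b - (b - a) / 4 ∈ Ioo a b := ⟨by linarith, by linarith⟩
  have h1 := h.flux_le hr₁
  have h2 := h.reflect.flux_le hr₁
  have e : a + b - (a + (b - a) / 4) = b - (b - a) / 4 := by ring
  simp only [e] at h2
  obtain ⟨ξ, hξ, he⟩ := exists_hasDerivAt_eq_slope (fun s => ρ s * v s)
    (fun r => -lam * ρ r * u r) (a := a + (b - a) / 4) (b := b - (b - a) / 4) (by linarith)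
    (fun x hx => (h.flux x ⟨by linarith [hx.1], by linarith [hx.2]⟩).continuousAt.continuousWithinAt)
    fun x hx => h.flux x ⟨by linarith [hx.1], by linarith [hx.2]⟩
  have hξ' : ξ ∈ Ioo a b := ⟨by linarith [hξ.1], by linarith [hξ.2]⟩
  rw [eq_div_iff (by linarith)] at he
  have h3 := h.lower_bound hr₀ hv₀ hξ'
  have h4 : u r₀ * ((b - a) / 4) ≤ Q * (b - a) * u ξ :=
    (mul_le_mul_of_nonneg_left (le_min (by linarith [hξ.1]) (by linarith [hξ.2])) hM.le).trans h3
  have h5 : u r₀ ≤ 4 * Q * u ξ := by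
    refine le_of_mul_le_mul_right ?_ hd
    linarith
  have h6 : Q * A * u (a + (b - a) / 4) ≤ Q * A * u r₀ :=
    mul_le_mul_of_nonneg_left (hmax _ hr₁) (by positivity)
  have h7 : Q * A * u (b - (b - a) / 4) ≤ Q * A * u r₀ :=
    mul_le_mul_of_nonneg_left (hmax _ hr₂) (by positivity)
  have h8 : lam * ρ ξ * u ξ * (b - a) ^ 2 ≤ 16 * (Q * A * u r₀) := by
    linear_combination (8 : ℝ) * h1 + 8 * h2 + 8 * h6 + 8 * h7 - 2 * (b - a) * he
  have h9 : lam * A * u ξ * (b - a) ^ 2 ≤ lam * ρ ξ * u ξ * (b - a) ^ 2 := by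
    have := h.lower ξ hξ'
    have := h.pos ξ hξ'
    have := h.eigen_nonneg
    gcongr
  have h10 : lam * A * u r₀ * (b - a) ^ 2 ≤ 4 * Q * (lam * A * u ξ * (b - a) ^ 2) := by
    have : lam * A * (b - a) ^ 2 * u r₀ ≤ lam * A * (b - a) ^ 2 * (4 * Q * u ξ) := by
      have := h.eigen_nonneg
      gcongr
    linarith
  have h11 : 4 * Q * (lam * A * u ξ * (b - a) ^ 2) ≤ 4 * Q * (16 * (Q * A * u r₀)) :=
    mul_le_mul_of_nonneg_left (h9.trans h8) (by positivity)
  refine le_of_mul_le_mul_right ?_ (mul_pos hA hM)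
  linarith

lemma upper_left (h : SturmProfile a b lam A Q u v ρ) {r₀ : ℝ} (hr₀ : r₀ ∈ Ioo a b)
    (hv₀ : v r₀ = 0) (hmax : ∀ r ∈ Ioo a b, u r ≤ u r₀) {r : ℝ} (hr : r ∈ Ioo a b) :
    u r * (b - a) ≤ 64 * Q ^ 3 * u r₀ * (r - a) := by
  have hA := h.weight_pos
  have hQ := h.one_le
  have hlam := h.eigen_nonneg
  have hM := h.pos r₀ hr₀
  have hra : 0 < r - a := sub_pos.2 hr.1
  have hd : 0 < b - a := sub_pos.2 h.lt
  obtain ⟨ξ, hξ, hξr, he⟩ := h.exists_slope_left hr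
  have hB : 0 ≤ lam * (Q * A) * u r₀ * (b - a) := by positivity
  have hflux : ρ ξ * v ξ ≤ lam * (Q * A) * u r₀ * (b - a) := by
    rcases lt_or_ge ξ r₀ with hlt | hge
    · obtain ⟨η, hη, hη'⟩ := exists_hasDerivAt_eq_slope (fun s => ρ s * v s)
        (fun r => -lam * ρ r * u r) hlt
        (fun x hx => (h.flux x ⟨hξ.1.trans_le hx.1,
          hx.2.trans_lt hr₀.2⟩).continuousAt.continuousWithinAt)
        fun x hx => h.flux x ⟨hξ.1.trans hx.1, hx.2.trans hr₀.2⟩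
      rw [eq_div_iff (by linarith), hv₀, mul_zero] at hη'
      have hηI : η ∈ Ioo a b := ⟨hξ.1.trans hη.1, hη.2.trans hr₀.2⟩
      have h1 := h.upper η hηI
      have h2 := hmax η hηI
      have h3 := (h.pos η hηI).le
      have h4 : 0 ≤ ρ η := hA.le.trans (h.lower η hηI)
      have h5 : r₀ - ξ ≤ b - a := by linarith [hr₀.2, hξ.1]
      have h6 : 0 ≤ r₀ - ξ := by linarith
      calc ρ ξ * v ξ = lam * ρ η * u η * (r₀ - ξ) := by linear_combination hη'
        _ ≤ _ := by gcongr
    · refine le_trans ?_ hB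
      simpa [hv₀] using h.flux_anti hr₀ hξ hge
  have h1 : A * v ξ ≤ A * (lam * Q * u r₀ * (b - a)) :=
    (h.mul_slope_le hξ hB hflux).trans (by linarith)
  have h2 : v ξ ≤ lam * Q * u r₀ * (b - a) := le_of_mul_le_mul_left h1 hA
  calc u r * (b - a) = v ξ * ((r - a) * (b - a)) := by rw [he]; ring
    _ ≤ lam * Q * u r₀ * (b - a) * ((r - a) * (b - a)) := by gcongr
    _ = lam * (b - a) ^ 2 * (Q * u r₀ * (r - a)) := by ring
    _ ≤ 64 * Q ^ 2 * (Q * u r₀ * (r - a)) :=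
        mul_le_mul_of_nonneg_right h.eigen_mul_sq_le (by positivity)
    _ = 64 * Q ^ 3 * u r₀ * (r - a) := by ring

/-- Positive Dirichlet solutions are comparable to the distance to the boundary. -/
theorem exists_comparable (h : SturmProfile a b lam A Q u v ρ) :
    ∃ M > 0, ∀ r ∈ Ioo a b, M * min (r - a) (b - r) ≤ Q * (b - a) * u r ∧
      u r * (b - a) ≤ 64 * Q ^ 3 * M * min (r - a) (b - r) := by
  obtain ⟨r₀, hr₀, hv₀, hmax⟩ := h.exists_max
  refine ⟨u r₀, h.pos r₀ hr₀, fun r hr => ⟨h.lower_bound hr₀ hv₀ hr, ?_⟩⟩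
  rcases min_choice (r - a) (b - r) with hm | hm
  · rw [hm]
    exact h.upper_left hr₀ hv₀ hmax hr
  · have := h.reflect.upper_left (r₀ := a + b - r₀) ⟨by linarith [hr₀.2], by linarith [hr₀.1]⟩
      (by simpa using hv₀)
      (fun s hs => by
        simpa using hmax (a + b - s) ⟨by linarith [hs.2], by linarith [hs.1]⟩)
      (r := a + b - r) ⟨by linarith [hr.2], by linarith [hr.1]⟩
    simp only [sub_sub_cancel] at this
    rw [hm]
    refine this.trans_eq ?_
    ring

end SturmProfile

section Radial

variable {n : ℕ} {a b : ℝ}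

/-- The radial equation satisfied by a rotation invariant solution of `Δφ = -lam φ`. -/
lemma radial_equation {φ : EuclideanSpace ℝ (Fin n) → ℝ} {lam : ℝ} (i₀ : Fin n) (ha : 0 < a)
    (hφ : ∀ x ∈ annulus n a b, ContDiffAt ℝ 2 φ x)
    (hrad : ∀ x ∈ annulus n a b, ∀ y, ‖x‖ = ‖y‖ → φ x = φ y)
    (heq : ∀ x ∈ annulus n a b, laplacian φ x = -lam * φ x) {r : ℝ} (hr : r ∈ Ioo a b) :
    HasDerivAt (fun s => φ (s • EuclideanSpace.single i₀ 1))
      (fderiv ℝ φ (r • EuclideanSpace.single i₀ 1) (EuclideanSpace.single i₀ 1)) r ∧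
    HasDerivAt (fun s => fderiv ℝ φ (s • EuclideanSpace.single i₀ 1) (EuclideanSpace.single i₀ 1))
      (-lam * φ (r • EuclideanSpace.single i₀ 1) - (n - 1) *
        (fderiv ℝ φ (r • EuclideanSpace.single i₀ 1) (EuclideanSpace.single i₀ 1) / r)) r := by
  set e : EuclideanSpace ℝ (Fin n) := EuclideanSpace.single i₀ 1 with he
  have hne : ‖e‖ = 1 := by simp [he]
  have hnorm : ∀ s ∈ Ioo a b, ‖s • e‖ = s := fun s hs => by
    rw [norm_smul, hne, mul_one, Real.norm_of_nonneg (ha.trans hs.1).le]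
  have hmem : ∀ s ∈ Ioo a b, s • e ∈ annulus n a b := fun s hs =>
    ⟨(hnorm s hs).symm ▸ hs.1, (hnorm s hs).symm ▸ hs.2⟩
  set v : ℝ → ℝ := fun s => fderiv ℝ φ (s • e) e with hv
  have hlin : ∀ s : ℝ, HasDerivAt (fun s : ℝ => s • e) e s := fun s => by
    simpa using (hasDerivAt_id s).smul_const e
  have hu : ∀ s ∈ Ioo a b, HasDerivAt (fun s => φ (s • e)) (v s) s := fun s hs =>
    ((hφ _ (hmem s hs)).differentiableAt (by norm_num)).hasFDerivAt.comp_hasDerivAt s (hlin s)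
  refine ⟨hu r hr, ?_⟩
  have hφr := hφ _ (hmem r hr)
  have hr0 : 0 < r := ha.trans hr.1
  have hv' : HasDerivAt v (fderiv ℝ (fun y => fderiv ℝ φ y e) (r • e) e) r := by
    have h := (hφr.differentiableAt_fderiv_apply e).hasFDerivAt
    exact h.comp_hasDerivAt r (hlin r)
  have htan : ∀ i ∈ Finset.univ.erase i₀, fderiv ℝ (fun y => fderiv ℝ φ y
      (EuclideanSpace.single i 1)) (r • e) (EuclideanSpace.single i 1) = v r / r := by
    intro i hi
    have hi : i ≠ i₀ := Finset.ne_of_mem_erase hi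
    set q : ℝ → ℝ := fun t => √(r ^ 2 + t ^ 2) with hq
    have hqpos : ∀ t, 0 < q t := fun t => Real.sqrt_pos.2 (by positivity)
    have hq0 : q 0 = r := by simp [hq, Real.sqrt_sq hr0.le]
    have hq' : ∀ t, HasDerivAt q (t / q t) t := fun t => by
      have h1 : HasDerivAt (fun t : ℝ => r ^ 2 + t ^ 2) (2 * t) t := by
        simpa using ((hasDerivAt_id t).pow 2).const_add (r ^ 2)
      refine (h1.sqrt (by positivity)).congr_deriv ?_
      have := hqpos t
      simp only [hq] at this ⊢
      field_simp
    have hqn : ∀ t : ℝ, ‖r • e + t • EuclideanSpace.single i (1 : ℝ)‖ = q t := fun t => by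
      have h1 : inner ℝ (r • e) (t • EuclideanSpace.single i (1 : ℝ)) = 0 := by
        rw [inner_smul_left, inner_smul_right, he, EuclideanSpace.inner_single_left]
        simp [hi]
      rw [hq, eq_comm, Real.sqrt_eq_iff_mul_self_eq (by positivity) (norm_nonneg _), ← sq,
        norm_add_sq_real, h1, norm_smul, norm_smul, hne]
      simp
    have hqI : ∀ᶠ t in 𝓝 (0 : ℝ), q t ∈ Ioo a b :=
      (hq' 0).continuousAt.eventually_mem (by rw [hq0]; exact Ioo_mem_nhds hr.1 hr.2)
    refine hφr.fderiv_fderiv_eq_of_line (g := fun t => t * (v (q t) / q t)) ?_ ?_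
    · filter_upwards [hqI.eventually_nhds] with t ht
      have h1 : (fun s : ℝ => φ (r • e + s • EuclideanSpace.single i (1 : ℝ)))
          =ᶠ[𝓝 t] fun s => φ (q s • e) := by
        filter_upwards [ht] with s hs
        exact (hrad _ (hmem _ hs) _ (by rw [hnorm _ hs, hqn])).symm
      refine HasDerivAt.congr_of_eventuallyEq ?_ h1
      exact ((hu _ ht.self_of_nhds).comp t (hq' t)).congr_deriv (by ring)
    · have hvq : HasDerivAt v (fderiv ℝ (fun y => fderiv ℝ φ y e) (r • e) e) (q 0) := by
        rwa [hq0]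
      refine ((hasDerivAt_id (0 : ℝ)).mul
        ((hvq.comp (0 : ℝ) (hq' 0)).div (hq' 0) (hqpos 0).ne')).congr_deriv ?_
      simp [hq0]
  have hsum := heq _ (hmem r hr)
  rw [laplacian, ← Finset.add_sum_erase _ _ (Finset.mem_univ i₀), Finset.sum_congr rfl htan,
    Finset.sum_const, Finset.card_erase_of_mem (Finset.mem_univ i₀), Finset.card_univ,
    Fintype.card_fin, nsmul_eq_mul, Nat.cast_sub (by have := i₀.pos; omega), Nat.cast_one] at hsum
  exact hv'.congr_deriv (by linarith)

lemma IsPrincipalDirichletEigenfunction.sturmProfile (hn : 2 ≤ n) (ha : 0 < a) (hab : a < b)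
    (hb : b ≤ 2 * a) {φ : EuclideanSpace ℝ (Fin n) → ℝ}
    (hφ : IsPrincipalDirichletEigenfunction (annulus n a b) φ) (i₀ : Fin n) :
    SturmProfile a b (dirichletEigenvalue n (annulus n a b)) (a ^ (n - 1)) (2 ^ (n - 1))
      (fun r => φ (r • EuclideanSpace.single i₀ 1))
      (fun r => fderiv ℝ φ (r • EuclideanSpace.single i₀ 1) (EuclideanSpace.single i₀ 1))
      (fun r => r ^ (n - 1)) := by
  have hode := fun r (hr : r ∈ Ioo a b) => radial_equation i₀ ha
    (fun x hx => hφ.contDiffAt isOpen_annulus hx)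
    (fun x hx y hxy => hφ.eq_of_norm_eq hn ha hab hx hxy) hφ.eigenEq hr
  have hnorm : ∀ s : ℝ, 0 < s → ‖s • (EuclideanSpace.single i₀ 1 : EuclideanSpace ℝ (Fin n))‖ = s :=
    fun s hs => by simp [norm_smul, abs_of_pos hs]
  have hcont := hφ.continuousOn
  rw [closure_annulus ha hab] at hcont
  refine ⟨hab, dirichletEigenvalue_nonneg _, by positivity, one_le_pow₀ one_le_two, ?_,
    hφ.vanishes _ (mem_frontier_annulus ha hab (Or.inl (hnorm a ha))),
    hφ.vanishes _ (mem_frontier_annulus ha hab (Or.inr (hnorm b (ha.trans hab)))),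
    fun r hr => hφ.pos _ ?_, fun r hr => (hode r hr).1, fun r hr => ?_, fun r hr => ?_,
    fun r hr => ?_⟩
  · refine hcont.comp (by fun_prop) fun r hr => ?_
    have := hnorm r (ha.trans_le hr.1)
    exact ⟨this.symm ▸ hr.1, this.symm ▸ hr.2⟩
  · have := hnorm r (ha.trans hr.1)
    exact ⟨this.symm ▸ hr.1, this.symm ▸ hr.2⟩
  · have hr0 : 0 < r := ha.trans hr.1
    refine ((hasDerivAt_pow (n - 1) r).mul (hode r hr).2).congr_deriv ?_
    obtain ⟨m, rfl⟩ : ∃ m, n = m + 2 := ⟨n - 2, by omega⟩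
    have e : m + 2 - 1 = m + 1 := by omega
    simp only [e, Nat.add_sub_cancel]
    push_cast
    field_simp
    ring
  · exact pow_le_pow_left₀ ha.le hr.1.le _
  · rw [← mul_pow]
    exact pow_le_pow_left₀ (ha.trans hr.1).le (hr.2.le.trans hb) _

lemma IsPrincipalDirichletEigenfunction.exists_comparable (hn : 2 ≤ n) (ha : 0 < a) (hab : a < b)
    (hb : b ≤ 2 * a) {φ : EuclideanSpace ℝ (Fin n) → ℝ}
    (hφ : IsPrincipalDirichletEigenfunction (annulus n a b) φ) :
    ∃ M > 0, ∀ x ∈ annulus n a b,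
      M * min (‖x‖ - a) (b - ‖x‖) ≤ 2 ^ (n - 1) * (b - a) * φ x ∧
      φ x * (b - a) ≤ 64 * (2 ^ (n - 1)) ^ 3 * M * min (‖x‖ - a) (b - ‖x‖) := by
  obtain ⟨M, hM, h⟩ := (hφ.sturmProfile hn ha hab hb ⟨0, by omega⟩).exists_comparable
  refine ⟨M, hM, fun x hx => ?_⟩
  rw [hφ.eq_of_norm_eq hn ha hab hx
    (y := ‖x‖ • EuclideanSpace.single (⟨0, by omega⟩ : Fin n) 1) (by simp [norm_smul])]
  exact h ‖x‖ hx

lemma volume_real_annulus (hn : 2 ≤ n) (ha : 0 ≤ a) (hab : a ≤ b) :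
    volume.real (annulus n a b) =
      (b ^ n - a ^ n) * volume.real (Metric.ball (0 : EuclideanSpace ℝ (Fin n)) 1) := by
  have : Nontrivial (EuclideanSpace ℝ (Fin n)) :=
    Module.nontrivial_of_finrank_pos (R := ℝ) (by rw [finrank_euclideanSpace_fin]; omega)
  have h : annulus n a b = Metric.ball 0 b \ Metric.closedBall 0 a := by
    ext x
    simp [annulus, and_comm]
  rcases hab.eq_or_lt with rfl | hlt
  · rw [h, sdiff_eq_empty.2 Metric.ball_subset_closedBall]
    simp
  rw [h, measureReal_sdiff (Metric.closedBall_subset_ball hlt) measurableSet_closedBall,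
    measureReal_def, measureReal_def, measureReal_def, Measure.addHaar_ball _ _ (ha.trans hab),
    Measure.addHaar_closedBall _ _ ha, ENNReal.toReal_mul, ENNReal.toReal_mul,
    ENNReal.toReal_ofReal (pow_nonneg (ha.trans hab) _),
    ENNReal.toReal_ofReal (pow_nonneg ha _),
    finrank_euclideanSpace_fin]
  ring

end Radial

section Normalization

variable {n : ℕ} {a b : ℝ}

lemma pow_mul_sub_le_pow_succ_sub {s t : ℝ} (hs : 0 ≤ s) (hst : s ≤ t) (m : ℕ) :
    s ^ m * (t - s) ≤ t ^ (m + 1) - s ^ (m + 1) := by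
  have h : s ^ m * t ≤ t ^ m * t :=
    mul_le_mul_of_nonneg_right (pow_le_pow_left₀ hs hst m) (hs.trans hst)
  rw [pow_succ, pow_succ]
  linarith

lemma pow_succ_sub_le {s t : ℝ} (hs : 0 ≤ s) (hst : s ≤ t) (m : ℕ) :
    t ^ (m + 1) - s ^ (m + 1) ≤ (m + 1) * t ^ m * (t - s) := by
  induction m with
  | zero => simp
  | succ m ih =>
    have ht := hs.trans hst
    have h1 : s * (t ^ (m + 1) - s ^ (m + 1)) ≤ t * ((m + 1) * t ^ m * (t - s)) :=
      mul_le_mul hst ih (sub_nonneg.2 (pow_le_pow_left₀ hs hst _)) ht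
    push_cast
    calc t ^ (m + 1 + 1) - s ^ (m + 1 + 1)
        = t ^ (m + 1) * (t - s) + s * (t ^ (m + 1) - s ^ (m + 1)) := by ring
      _ ≤ t ^ (m + 1) * (t - s) + t * ((m + 1) * t ^ m * (t - s)) := by gcongr
      _ = _ := by ring

lemma volume_real_annulus_le (hn : 2 ≤ n) (ha : 0 < a) (hab : a < b) (hb : b ≤ 2 * a) :
    volume.real (annulus n a b) ≤ n * 2 ^ (n - 1) * (a ^ (n - 1) * (b - a)) *
      volume.real (Metric.ball (0 : EuclideanSpace ℝ (Fin n)) 1) := by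
  rw [volume_real_annulus hn ha.le hab.le]
  refine mul_le_mul_of_nonneg_right ?_ measureReal_nonneg
  obtain ⟨m, rfl⟩ : ∃ m, n = m + 1 := ⟨n - 1, by omega⟩
  have h1 := pow_succ_sub_le ha.le hab.le m
  have h2 : b ^ m ≤ (2 * a) ^ m := pow_le_pow_left₀ (ha.trans hab).le hb m
  have h3 := sub_pos.2 hab
  simp only [Nat.add_sub_cancel]
  push_cast
  calc _ ≤ _ := h1
    _ ≤ (m + 1) * (2 * a) ^ m * (b - a) := by gcongr
    _ = _ := by rw [mul_pow]; ring

lemma le_volume_real_annulus (hn : 2 ≤ n) (ha : 0 < a) (hab : a < b) :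
    a ^ (n - 1) * (b - a) * volume.real (Metric.ball (0 : EuclideanSpace ℝ (Fin n)) 1) ≤
      2 * volume.real (annulus n (a + (b - a) / 4) (b - (b - a) / 4)) := by
  rw [volume_real_annulus hn (by linarith) (by linarith), ← mul_assoc]
  refine mul_le_mul_of_nonneg_right ?_ measureReal_nonneg
  obtain ⟨m, rfl⟩ : ∃ m, n = m + 1 := ⟨n - 1, by omega⟩
  have h1 := pow_mul_sub_le_pow_succ_sub (s := a + (b - a) / 4) (t := b - (b - a) / 4)
    (by linarith) (by linarith) m
  have h2 : a ^ m ≤ (a + (b - a) / 4) ^ m := pow_le_pow_left₀ ha.le (by linarith) m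
  have h3 := mul_le_mul_of_nonneg_right h2 (sub_nonneg.2 hab.le)
  simp only [Nat.add_sub_cancel]
  linarith

lemma IsPrincipalDirichletEigenfunction.integrableOn_sq {U : Set (EuclideanSpace ℝ (Fin n))}
    {φ : EuclideanSpace ℝ (Fin n) → ℝ} (hφ : IsPrincipalDirichletEigenfunction U φ) :
    IntegrableOn (fun x => φ x ^ 2) U := by
  by_contra h
  have := hφ.normalized
  rw [integral_undef h] at this
  exact zero_ne_one this

/-- The constant of `exists_comparable` is determined by the normalization, up to a factor
depending only on the dimension. -/
lemma IsPrincipalDirichletEigenfunction.sq_mul_bounds (hn : 2 ≤ n) (ha : 0 < a) (hab : a < b)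
    (hb : b ≤ 2 * a) {φ : EuclideanSpace ℝ (Fin n) → ℝ}
    (hφ : IsPrincipalDirichletEigenfunction (annulus n a b) φ) {M Q : ℝ} (hM : 0 < M) (hQ : 0 < Q)
    (hlow : ∀ x ∈ annulus n a b, M * min (‖x‖ - a) (b - ‖x‖) ≤ Q * (b - a) * φ x)
    (hup : ∀ x ∈ annulus n a b, φ x * (b - a) ≤ 64 * Q ^ 3 * M * min (‖x‖ - a) (b - ‖x‖)) :
    1 ≤ 1024 * Q ^ 6 * (n * 2 ^ (n - 1)) *
      volume.real (Metric.ball (0 : EuclideanSpace ℝ (Fin n)) 1) *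
        (M ^ 2 * (a ^ (n - 1) * (b - a))) ∧
    M ^ 2 * (a ^ (n - 1) * (b - a)) * volume.real (Metric.ball (0 : EuclideanSpace ℝ (Fin n)) 1) ≤
      32 * Q ^ 2 := by
  have hh := sub_pos.2 hab
  have hint := hφ.integrableOn_sq
  have hmeas : ∀ s t : ℝ, MeasurableSet (annulus n s t) := fun s t => isOpen_annulus.measurableSet
  have hfin : volume (annulus n a b) ≠ ⊤ :=
    measure_ne_top_of_subset (fun x hx => mem_ball_zero_iff.2 hx.2) measure_ball_lt_top.ne
  constructor
  · have h1 : ∀ x ∈ annulus n a b, φ x ^ 2 ≤ (32 * Q ^ 3 * M) ^ 2 := fun x hx => by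
      refine pow_le_pow_left₀ (hφ.pos x hx).le ?_ 2
      refine le_of_mul_le_mul_right ((hup x hx).trans ?_) hh
      have hmin : min (‖x‖ - a) (b - ‖x‖) ≤ (b - a) / 2 := by
        linarith [min_le_left (‖x‖ - a) (b - ‖x‖), min_le_right (‖x‖ - a) (b - ‖x‖)]
      calc _ ≤ 64 * Q ^ 3 * M * ((b - a) / 2) := by gcongr
        _ = _ := by ring
    have h2 : (∫ x in annulus n a b, φ x ^ 2) ≤
        ∫ _ in annulus n a b, (32 * Q ^ 3 * M) ^ 2 :=
      setIntegral_mono_on hint (integrableOn_const hfin) (hmeas a b) h1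
    rw [hφ.normalized, setIntegral_const, smul_eq_mul] at h2
    have h3 := mul_le_mul_of_nonneg_right (volume_real_annulus_le hn ha hab hb)
      (sq_nonneg (32 * Q ^ 3 * M))
    linarith
  · have hsub : annulus n (a + (b - a) / 4) (b - (b - a) / 4) ⊆ annulus n a b := fun x hx =>
      ⟨by linarith [hx.1], by linarith [hx.2]⟩
    have h1 : ∀ x ∈ annulus n (a + (b - a) / 4) (b - (b - a) / 4), (M / (4 * Q)) ^ 2 ≤ φ x ^ 2 := by
      intro x hx
      refine pow_le_pow_left₀ (by positivity) ?_ 2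
      have hmin : (b - a) / 4 ≤ min (‖x‖ - a) (b - ‖x‖) :=
        le_min (by linarith [hx.1]) (by linarith [hx.2])
      rw [div_le_iff₀ (by positivity)]
      refine le_of_mul_le_mul_right ?_ hh
      have h := (mul_le_mul_of_nonneg_left hmin hM.le).trans (hlow x (hsub hx))
      linarith
    have h2 : (∫ _ in annulus n (a + (b - a) / 4) (b - (b - a) / 4), (M / (4 * Q)) ^ 2) ≤
        ∫ x in annulus n (a + (b - a) / 4) (b - (b - a) / 4), φ x ^ 2 :=
      setIntegral_mono_on (integrableOn_const (measure_ne_top_of_subset hsub hfin))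
        (hint.mono_set hsub) (hmeas _ _) h1
    have h3 := setIntegral_mono_set hint (Eventually.of_forall fun x => sq_nonneg (φ x))
      (Eventually.of_forall hsub)
    have h4 := h2.trans h3
    rw [hφ.normalized, setIntegral_const, smul_eq_mul, div_pow, mul_div_assoc',
      div_le_one (by positivity)] at h4
    have h5 := mul_le_mul_of_nonneg_right (le_volume_real_annulus hn ha hab) (sq_nonneg M)
    linarith

lemma scaling_identity (ha : 0 < a) (hab : a < b) (hn : 2 ≤ n) (d : ℝ) :
    a ^ (-((n : ℝ) / 2 + 1)) * d / (b / a - 1) ^ ((3 : ℝ) / 2) =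
      d / ((b - a) * √(a ^ (n - 1) * (b - a))) := by
  have hδ : 0 < b / a - 1 := by rw [sub_pos, one_lt_div ha]; exact hab
  have hh : b - a = a * (b / a - 1) := by field_simp
  generalize b / a - 1 = δ at hδ hh
  have h1 : √(a ^ (n - 1) * (b - a)) = a ^ ((n : ℝ) / 2) * δ ^ ((1 : ℝ) / 2) := by
    rw [hh, ← mul_assoc, ← pow_succ, Nat.sub_add_cancel (by omega), Real.sqrt_mul (by positivity),
      Real.sqrt_eq_rpow, Real.sqrt_eq_rpow, ← Real.rpow_natCast, ← Real.rpow_mul ha.le]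
    ring_nf
  have h2 : δ ^ ((3 : ℝ) / 2) = δ * δ ^ ((1 : ℝ) / 2) := by
    rw [← Real.rpow_one_add' hδ.le (by norm_num)]
    norm_num
  have h3 : a ^ (-((n : ℝ) / 2 + 1)) = (a * a ^ ((n : ℝ) / 2))⁻¹ := by
    rw [Real.rpow_neg ha.le, Real.rpow_add_one ha.ne', mul_comm]
  have := Real.rpow_pos_of_pos ha ((n : ℝ) / 2)
  have := Real.rpow_pos_of_pos hδ ((1 : ℝ) / 2)
  rw [h1, h2, h3, hh]
  field_simp

end Normalization

theorem stmt_18 (n : ℕ) (hn : 2 ≤ n) :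
    ∃ c > (0 : ℝ), ∃ C > (0 : ℝ), ∀ a b : ℝ, 0 < a → a < b →
      a / b ∈ Set.Ioo (1 / 2 : ℝ) 1 →
      ∀ φ : EuclideanSpace ℝ (Fin n) → ℝ,
        IsPrincipalDirichletEigenfunction (annulus n a b) φ →
        ∀ x ∈ annulus n a b,
          c * (a ^ (-((n : ℝ) / 2 + 1)) * min (‖x‖ - a) (b - ‖x‖) /
              (b / a - 1) ^ ((3 : ℝ) / 2)) ≤ φ x ∧
          φ x ≤ C * (a ^ (-((n : ℝ) / 2 + 1)) * min (‖x‖ - a) (b - ‖x‖) /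
              (b / a - 1) ^ ((3 : ℝ) / 2)) := by
  have hω : 0 < volume.real (Metric.ball (0 : EuclideanSpace ℝ (Fin n)) 1) :=
    ENNReal.toReal_pos (Metric.measure_ball_pos _ _ one_pos).ne' measure_ball_lt_top.ne
  set ω := volume.real (Metric.ball (0 : EuclideanSpace ℝ (Fin n)) 1)
  set Q : ℝ := 2 ^ (n - 1) with hQ
  have hQ0 : 0 < Q := by positivity
  set K : ℝ := 1024 * Q ^ 6 * (n * 2 ^ (n - 1)) * ω with hK
  have hK0 : 0 < K := by
    have : (0 : ℝ) < n := by exact_mod_cast (by omega : 0 < n)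
    positivity
  refine ⟨√(1 / K) / Q, by positivity, 64 * Q ^ 3 * √(32 * Q ^ 2 / ω), by positivity, ?_⟩
  intro a b ha hab hratio φ hφ x hx
  have hb : b ≤ 2 * a := by
    have := (lt_div_iff₀ (ha.trans hab)).1 hratio.1
    linarith
  have hh := sub_pos.2 hab
  obtain ⟨M, hM, hcmp⟩ := hφ.exists_comparable hn ha hab hb
  obtain ⟨hl, hu⟩ := hφ.sq_mul_bounds hn ha hab hb hM hQ0 (fun x hx => (hcmp x hx).1)
    fun x hx => (hcmp x hx).2
  rw [scaling_identity ha hab hn]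
  set X := a ^ (n - 1) * (b - a) with hX
  have hX0 : 0 < X := by positivity
  have hMX : √(M ^ 2 * X) = M * √X := by rw [Real.sqrt_mul (sq_nonneg M), Real.sqrt_sq hM.le]
  have hl' : √(1 / K) ≤ M * √X := by
    rw [← hMX]
    exact Real.sqrt_le_sqrt ((div_le_iff₀' hK0).2 hl)
  have hu' : M * √X ≤ √(32 * Q ^ 2 / ω) := by
    rw [← hMX]
    exact Real.sqrt_le_sqrt ((le_div_iff₀ hω).2 hu)
  have hXs : 0 < √X := Real.sqrt_pos.2 hX0
  set d := min (‖x‖ - a) (b - ‖x‖) with hd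
  have hd0 : 0 < d := lt_min (sub_pos.2 hx.1) (sub_pos.2 hx.2)
  obtain ⟨h1, h2⟩ := hcmp x hx
  constructor
  · calc √(1 / K) / Q * (d / ((b - a) * √X)) ≤ M * √X / Q * (d / ((b - a) * √X)) := by gcongr
      _ = M * d / (Q * (b - a)) := by field_simp
      _ ≤ φ x := (div_le_iff₀' (by positivity)).2 h1
  · calc φ x ≤ 64 * Q ^ 3 * M * d / (b - a) := (le_div_iff₀ hh).2 h2
      _ = 64 * Q ^ 3 * (M * √X) * (d / ((b - a) * √X)) := by field_simp
      _ ≤ 64 * Q ^ 3 * √(32 * Q ^ 2 / ω) * (d / ((b - a) * √X)) := by gcongr
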